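/- arXiv:0905.1390 — 8 statements merged into one kernel-verified Lean document; each statement's English description precedes it below -/
import Mathlib

section
/- Let S : ℝ × ℝ → ℝ be a differentiable function such that for every x ∈ ℝ the map y ↦ ∂₁S(x,y) is a bijection of ℝ onto ℝ, and let F : ℝ² → ℝ² be the (well-defined) map satisfying F(x, −∂₁S(x,y)) = (y, ∂₂S(x,y)) for all x, y ∈ ℝ. If F is bijective and reversible, i.e. T ∘ F ∘ T = F⁻¹ where T(x,u) = (x,−u), then ∂₁S(y,x) = ∂₂S(x,y) for all x, y ∈ ℝ. -/
/-- If the area-preserving map `F` generated by `S` via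
`F (x, -∂₁S(x,y)) = (y, ∂₂S(x,y))` is bijective and reversible
(`T ∘ F ∘ T = F⁻¹` with `T (x,u) = (x,-u)`), then `∂₁S(y,x) = ∂₂S(x,y)`. -/
theorem stmt0
    (S : ℝ × ℝ → ℝ) (hS : Differentiable ℝ S)
    (S1 S2 : ℝ → ℝ → ℝ)
    (hS1 : ∀ x y, S1 x y = fderiv ℝ S (x, y) (1, 0))
    (hS2 : ∀ x y, S2 x y = fderiv ℝ S (x, y) (0, 1))
    (hbij : ∀ x, Function.Bijective fun y => S1 x y)
    (F : ℝ × ℝ → ℝ × ℝ)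
    (hF : ∀ x y, F (x, -S1 x y) = (y, S2 x y))
    (hFbij : Function.Bijective F)
    (T : ℝ × ℝ → ℝ × ℝ) (hT : ∀ p, T p = (p.1, -p.2))
    (hrev : ∀ p, T (F (T p)) = Function.invFun F p) :
    ∀ x y, S1 y x = S2 x y := by
  intro x y
  obtain ⟨z, hz⟩ := (hbij y).2 (S2 x y)
  have hinv : Function.invFun F (y, S2 x y) = (x, -S1 x y) := by
    rw [← hF x y]
    exact Function.leftInverse_invFun hFbij.1 _
  have h := (hrev (y, S2 x y)).trans hinv
  have hz' : S1 y z = S2 x y := hz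
  rw [hT (y, S2 x y), ← hz', hF, hT] at h
  have hzx : z = x := congrArg Prod.fst h
  rwa [hzx] at hz'
end

section
/- Let s : ℝ × ℝ → ℝ be continuously differentiable with ∂₁s(a,b) = ∂₁s(b,a) for all a, b ∈ ℝ, let U ⊆ ℝ² be open, and let y : U → ℝ be differentiable with u + s(y(x,u), x) = 0 for all (x,u) ∈ U and ∂₁s(y(x,u), x) ≠ 0. Define F : U → ℝ² by F(x,u) = (y(x,u), s(x, y(x,u))). Then F is area-preserving: det DF(x,u) = 1 at every (x,u) ∈ U. -/
/-- if the generating function `s` satisfies the symmetry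
`∂₁s(a,b) = ∂₁s(b,a)`, then the map `F (x,u) = (y(x,u), s(x, y(x,u)))`,
where `y(x,u)` solves `u + s(y,x) = 0`, is area-preserving:
`det DF (x,u) = 1` on `U`. -/
theorem stmt2
    (s : ℝ × ℝ → ℝ) (hs : ContDiff ℝ 1 s)
    (s1 : ℝ → ℝ → ℝ)
    (hs1 : ∀ a b, s1 a b = fderiv ℝ s (a, b) (1, 0))
    (hsym : ∀ a b, s1 a b = s1 b a)
    (U : Set (ℝ × ℝ)) (hU : IsOpen U)
    (y : ℝ × ℝ → ℝ) (hy : DifferentiableOn ℝ y U)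
    (hsol : ∀ p ∈ U, p.2 + s (y p, p.1) = 0)
    (hne : ∀ p ∈ U, s1 (y p) p.1 ≠ 0)
    (F : ℝ × ℝ → ℝ × ℝ)
    (hF : ∀ p, F p = (y p, s (p.1, y p))) :
    ∀ p ∈ U,
      (fderiv ℝ F p (1, 0)).1 * (fderiv ℝ F p (0, 1)).2 -
        (fderiv ℝ F p (0, 1)).1 * (fderiv ℝ F p (1, 0)).2 = 1 := by
  intro p hp
  have hsd : Differentiable ℝ s := hs.differentiable one_ne_zero
  have hyp : HasFDerivAt y (fderiv ℝ y p) p :=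
    (hy.differentiableAt (hU.mem_nhds hp)).hasFDerivAt
  have hfst : HasFDerivAt (fun q : ℝ × ℝ => q.1) (ContinuousLinearMap.fst ℝ ℝ ℝ) p :=
    hasFDerivAt_fst
  have hsnd : HasFDerivAt (fun q : ℝ × ℝ => q.2) (ContinuousLinearMap.snd ℝ ℝ ℝ) p :=
    hasFDerivAt_snd
  have hconstraint := hsnd.add
    ((hsd (y p, p.1)).hasFDerivAt.comp p (hyp.prodMk hfst))
  have hzero : HasFDerivAt (fun _ : ℝ × ℝ => (0 : ℝ)) (0 : ℝ × ℝ →L[ℝ] ℝ) p :=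
    hasFDerivAt_const 0 p
  have hvanish := hconstraint.unique <| hzero.congr_of_eventuallyEq <| by
    filter_upwards [hU.mem_nhds hp] with q hq using hsol q hq
  have hFp : HasFDerivAt F ((fderiv ℝ y p).prod ((fderiv ℝ s (p.1, y p)).comp
      ((ContinuousLinearMap.fst ℝ ℝ ℝ).prod (fderiv ℝ y p)))) p := by
    rw [funext hF]
    exact hyp.prodMk ((hsd (p.1, y p)).hasFDerivAt.comp p (hfst.prodMk hyp))
  have hsplit (L : ℝ × ℝ →L[ℝ] ℝ) (a b : ℝ) : L (a, b) = a * L (1, 0) + b * L (0, 1) := by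
    rw [← smul_eq_mul, ← smul_eq_mul, ← map_smul, ← map_smul, ← map_add]
    simp
  have hu : 1 + fderiv ℝ y p (0, 1) * s1 (y p) p.1 = 0 := by
    have h := congrArg (fun L : ℝ × ℝ →L[ℝ] ℝ => L (0, 1)) hvanish
    simp only [add_apply, ContinuousLinearMap.comp_apply,
      ContinuousLinearMap.prod_apply, ContinuousLinearMap.coe_fst', ContinuousLinearMap.coe_snd',
      zero_apply] at h
    rw [hsplit _ (fderiv ℝ y p (0, 1)) 0, ← hs1] at h
    linarith
  rw [hsym, hs1] at hu
  rw [hFp.fderiv]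
  simp only [ContinuousLinearMap.comp_apply, ContinuousLinearMap.prod_apply,
    ContinuousLinearMap.coe_fst']
  rw [hsplit _ 1 (fderiv ℝ y p (1, 0)), hsplit _ 0 (fderiv ℝ y p (0, 1))]
  linear_combination -hu
end

section
/- Let s : ℝ × ℝ → ℝ be such that for every b ∈ ℝ the map a ↦ s(a,b) is a bijection of ℝ onto ℝ, and let F : ℝ² → ℝ² be the (well-defined) map F(x,u) = (y, s(x,y)) where y is the unique solution of u = −s(y,x). Let λ ≠ 0, μ ≠ 0 and Λ(x,u) = (λx, μu). Assume that for every (x,y) ∈ ℝ² there exists a unique z(x,y) ∈ ℝ with s(λx, z(x,y)) + s(λy, z(x,y)) = 0. Then: (i) z(x,y) = z(y,x) for all x, y; and (ii) setting s̃(x,y) = μ⁻¹ s(z(x,y), λy), the renormalized map satisfies (Λ⁻¹ ∘ F ∘ F ∘ Λ)(x, −s̃(y,x)) = (y, s̃(x,y)) for all x, y ∈ ℝ; i.e. s̃ is a generating function for Λ⁻¹ ∘ F ∘ F ∘ Λ. -/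
/-- renormalization of the generating function.  For the map
`F (x,u) = (y, s(x,y))` with `u = -s(y,x)`, the scaling `Λ (x,u) = (λx, μu)`,
and the midpoint function `z` solving `s(λx, z) + s(λy, z) = 0` uniquely:
(i) `z` is symmetric, and (ii) `s̃(x,y) = μ⁻¹ s(z(x,y), λy)` is a generating
function for the renormalized map `Λ⁻¹ ∘ F ∘ F ∘ Λ`. -/
theorem stmt4
    (s : ℝ → ℝ → ℝ)
    (hbij : ∀ b, Function.Bijective fun a => s a b)
    (F : ℝ × ℝ → ℝ × ℝ)
    (hF : ∀ x y, F (x, -s y x) = (y, s x y))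
    (lam mu : ℝ) (hlam : lam ≠ 0) (hmu : mu ≠ 0)
    (Lam LamInv : ℝ × ℝ → ℝ × ℝ)
    (hLam : ∀ p, Lam p = (lam * p.1, mu * p.2))
    (hLamInv : ∀ p, LamInv p = (p.1 / lam, p.2 / mu))
    (z : ℝ → ℝ → ℝ)
    (hz : ∀ x y, s (lam * x) (z x y) + s (lam * y) (z x y) = 0)
    (hzuniq : ∀ x y w, s (lam * x) w + s (lam * y) w = 0 → w = z x y) :
    (∀ x y, z x y = z y x) ∧
      ∀ x y,
        LamInv (F (F (Lam (x, -(mu⁻¹ * s (z y x) (lam * x)))))) =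
          (y, mu⁻¹ * s (z x y) (lam * y)) := by
  have hsymm : ∀ x y, z x y = z y x := fun x y =>
    hzuniq y x _ (by linarith [hz x y])
  refine ⟨hsymm, fun x y => ?_⟩
  have hscale : mu * -(mu⁻¹ * s (z y x) (lam * x)) = -s (z x y) (lam * x) := by
    rw [hsymm x y]
    field_simp
  have hmid : s (lam * x) (z x y) = -s (lam * y) (z x y) := by
    linarith [hz x y]
  rw [hLam, hscale, hF, hmid, hF, hLamInv]
  ext
  · exact mul_div_cancel_left₀ y hlam
  · exact div_eq_inv_mul _ _
end

section
/- Let n ∈ ℕ, let N ⊆ ℝⁿ be a convex set, let f : ℝⁿ → ℝⁿ be differentiable on a neighbourhood of N, let Q_N and Q_M be quadratic forms on ℝⁿ, and let S be a closed convex set of linear maps ℝⁿ → ℝⁿ such that Df(x) ∈ S for all x ∈ N. If for every B ∈ S the quadratic form v ↦ Q_M(B v) − Q_N(v) is positive definite, then for all p₁, p₂ ∈ N with p₁ ≠ p₂ one has Q_M(f(p₁) − f(p₂)) > Q_N(p₁ − p₂). -/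
/-- In finite dimension, a point outside a convex set (with no topological assumption on the set)
can be weakly separated from it by a nonzero functional. -/
theorem Convex.exists_ne_zero_forall_nonpos {E : Type*} [NormedAddCommGroup E] [NormedSpace ℝ E]
    [FiniteDimensional ℝ E] [Nontrivial E] {C : Set E} (hC : Convex ℝ C) (h0 : (0 : E) ∉ C) :
    ∃ l : E →L[ℝ] ℝ, l ≠ 0 ∧ ∀ c ∈ C, l c ≤ 0 := by
  by_cases hint : (interior C).Nonempty
  · obtain ⟨l, hl, hle⟩ := geometric_hahn_banach_of_nonempty_interior_point hC
      (fun h => h0 (interior_subset h)) hint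
    exact ⟨l, hl, fun c hc => by simpa using hle c hc⟩
  · rcases C.eq_empty_or_nonempty with rfl | hne
    · obtain ⟨x, hx⟩ := exists_ne (0 : E)
      obtain ⟨l, hl⟩ := geometric_hahn_banach_point_point hx
      exact ⟨l, by rintro rfl; simp at hl, by simp⟩
    obtain ⟨c₀, hc₀⟩ := hne
    have hspan : vectorSpan ℝ C < ⊤ := by
      rw [lt_top_iff_ne_top, ne_eq,
        ← AffineSubspace.affineSpan_eq_top_iff_vectorSpan_eq_top_of_nonempty ℝ E E ⟨c₀, hc₀⟩,
        ← hC.interior_nonempty_iff_affineSpan_eq_top]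
      exact hint
    obtain ⟨l, hl, hker⟩ := Submodule.exists_le_ker_of_lt_top _ hspan
    have hl' : LinearMap.toContinuousLinearMap l ≠ 0 := by simpa using hl
    have hconst : ∀ c ∈ C, l c = l c₀ := fun c hc => by
      have := hker (vsub_mem_vectorSpan ℝ hc hc₀)
      simpa [sub_eq_zero] using this
    rcases le_total (l c₀) 0 with h | h
    · exact ⟨LinearMap.toContinuousLinearMap l, hl', fun c hc => by simpa [hconst c hc] using h⟩
    · exact ⟨-LinearMap.toContinuousLinearMap l, neg_ne_zero.2 hl',
        fun c hc => by simpa [hconst c hc] using h⟩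

/-- A real function on `[0, 1]` with equal endpoint values and nonpositive derivative has zero
derivative. -/
theorem hasDerivAt_eq_zero_of_nonpos_of_eq {h h' : ℝ → ℝ} (hcont : ContinuousOn h (Set.Icc 0 1))
    (hderiv : ∀ t ∈ Set.Ioo (0 : ℝ) 1, HasDerivAt h (h' t) t)
    (hnonpos : ∀ t ∈ Set.Ioo (0 : ℝ) 1, h' t ≤ 0) (heq : h 0 = h 1) :
    ∀ t ∈ Set.Ioo (0 : ℝ) 1, h' t = 0 := by
  have hanti : AntitoneOn h (Set.Icc 0 1) := by
    apply antitoneOn_of_deriv_nonpos (convex_Icc 0 1) hcont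
    · rw [interior_Icc]
      exact fun t ht => (hderiv t ht).differentiableAt.differentiableWithinAt
    · rw [interior_Icc]
      exact fun t ht => (hderiv t ht).deriv.trans_le (hnonpos t ht)
  have hconst : ∀ t ∈ Set.Icc (0 : ℝ) 1, h t = h 0 := fun t ht =>
    le_antisymm (hanti (by simp) ht ht.1) (heq.trans_le (hanti ht (by simp) ht.2))
  intro t ht
  refine (hderiv t ht).unique ((hasDerivAt_const t (h 0)).congr_of_eventuallyEq ?_)
  filter_upwards [Ioo_mem_nhds ht.1 ht.2] with s hs
  exact hconst s (Set.Ioo_subset_Icc_self hs)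

/-- Rolle's theorem for curves: if a curve in a finite-dimensional space has equal endpoints,
then every convex set containing all its velocities contains `0`. -/
theorem Convex.zero_mem_of_hasDerivAt {E : Type*} [NormedAddCommGroup E] [NormedSpace ℝ E]
    [FiniteDimensional ℝ E] {C : Set E} (hC : Convex ℝ C) {g g' : ℝ → E}
    (hcont : ContinuousOn g (Set.Icc 0 1))
    (hderiv : ∀ t ∈ Set.Ioo (0 : ℝ) 1, HasDerivAt g (g' t) t)
    (hmem : ∀ t ∈ Set.Ioo (0 : ℝ) 1, g' t ∈ C) (heq : g 0 = g 1) : (0 : E) ∈ C := by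
  induction hd : Module.finrank ℝ E using Nat.strong_induction_on generalizing E with
  | _ d ih =>
    by_contra h0
    rcases subsingleton_or_nontrivial E with hE | hE
    · have := hmem (1 / 2) (by norm_num)
      rw [Subsingleton.elim (g' (1 / 2)) 0] at this
      exact h0 this
    obtain ⟨l, hl, hle⟩ := hC.exists_ne_zero_forall_nonpos h0
    have hzero : ∀ t ∈ Set.Ioo (0 : ℝ) 1, l (g' t) = 0 :=
      hasDerivAt_eq_zero_of_nonpos_of_eq (h := fun t => l (g t)) (h' := fun t => l (g' t))
        (l.continuous.comp_continuousOn hcont)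
        (fun t ht => l.hasFDerivAt.comp_hasDerivAt t (hderiv t ht))
        (fun t ht => hle _ (hmem t ht)) (by simp [heq])
    let K : Submodule ℝ E := LinearMap.ker (l : E →ₗ[ℝ] ℝ)
    obtain ⟨π, hπ⟩ := Submodule.ClosedComplemented.of_finiteDimensional (𝕜 := ℝ) K
    have hK : Module.finrank ℝ K < d := by
      rw [← hd]
      apply Submodule.finrank_lt
      rw [ne_eq, LinearMap.ker_eq_top]
      exact fun h => hl (by ext x; exact LinearMap.congr_fun h x)
    have hmem0 := ih _ hK (hC.linear_preimage K.subtype) (g := fun t => π (g t))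
      (g' := fun t => π (g' t)) (π.continuous.comp_continuousOn hcont)
      (fun t ht => π.hasFDerivAt.comp_hasDerivAt t (hderiv t ht))
      (fun t ht => by
        have : π (g' t) = ⟨g' t, hzero t ht⟩ := hπ ⟨g' t, hzero t ht⟩
        simpa [this] using hmem t ht)
      (by simp [heq]) rfl
    exact h0 (by simpa using hmem0)

/-- Mean value theorem for curves in a finite-dimensional space: the increment over `[0, 1]` lies
in every convex set containing all the velocities. -/
theorem Convex.sub_mem_of_hasDerivAt {E : Type*} [NormedAddCommGroup E] [NormedSpace ℝ E]
    [FiniteDimensional ℝ E] {C : Set E} (hC : Convex ℝ C) {g g' : ℝ → E}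
    (hcont : ContinuousOn g (Set.Icc 0 1))
    (hderiv : ∀ t ∈ Set.Ioo (0 : ℝ) 1, HasDerivAt g (g' t) t)
    (hmem : ∀ t ∈ Set.Ioo (0 : ℝ) 1, g' t ∈ C) : g 1 - g 0 ∈ C := by
  have := (hC.translate_preimage_left (g 1 - g 0)).zero_mem_of_hasDerivAt
    (g := fun t => g t - t • (g 1 - g 0)) (g' := fun t => g' t - (g 1 - g 0))
    (hcont.sub (by fun_prop))
    (fun t ht => by
      have := (hderiv t ht).fun_sub ((hasDerivAt_id' t).smul_const (g 1 - g 0))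
      rwa [one_smul] at this)
    (fun t ht => by simpa using hmem t ht) (by simp)
  simpa using this

/-- Lemma 8 of [Z09], qualitative version: if every linear map
`B` in a closed convex enclosure `S` of the derivative of `f` over a convex
set `N` makes the quadratic form `v ↦ Q_M(Bv) - Q_N(v)` positive definite,
then `Q_M(f(p₁) - f(p₂)) > Q_N(p₁ - p₂)` for all distinct `p₁, p₂ ∈ N`. -/
theorem stmt5 (n : ℕ)
    (N : Set (EuclideanSpace ℝ (Fin n))) (hN : Convex ℝ N)
    (f : EuclideanSpace ℝ (Fin n) → EuclideanSpace ℝ (Fin n))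
    (hf : ∃ U, IsOpen U ∧ N ⊆ U ∧ DifferentiableOn ℝ f U)
    (QN QM : QuadraticForm ℝ (EuclideanSpace ℝ (Fin n)))
    (S : Set (EuclideanSpace ℝ (Fin n) →L[ℝ] EuclideanSpace ℝ (Fin n)))
    (hSclosed : IsClosed S) (hSconvex : Convex ℝ S)
    (hDf : ∀ x ∈ N, fderiv ℝ f x ∈ S)
    (hpos : ∀ B ∈ S, ∀ v : EuclideanSpace ℝ (Fin n), v ≠ 0 → QN v < QM (B v)) :
    ∀ p₁ ∈ N, ∀ p₂ ∈ N, p₁ ≠ p₂ → QN (p₁ - p₂) < QM (f p₁ - f p₂) := by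
  intro p₁ hp₁ p₂ hp₂ hne
  obtain ⟨U, hU, hNU, hfU⟩ := hf
  have hline : ∀ t ∈ Set.Icc (0 : ℝ) 1, AffineMap.lineMap p₂ p₁ t ∈ N := fun t ht =>
    hN.lineMap_mem hp₂ hp₁ ht
  have hderiv : ∀ t ∈ Set.Icc (0 : ℝ) 1,
      HasDerivAt (fun s : ℝ => f (AffineMap.lineMap p₂ p₁ s))
        (fderiv ℝ f (AffineMap.lineMap p₂ p₁ t) (p₁ - p₂)) t := fun t ht =>
    (hfU.differentiableAt (hU.mem_nhds (hNU (hline t ht)))).hasFDerivAt.comp_hasDerivAt t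
      AffineMap.hasDerivAt_lineMap
  have hconv : Convex ℝ ((fun B : EuclideanSpace ℝ (Fin n) →L[ℝ] EuclideanSpace ℝ (Fin n) =>
      B (p₁ - p₂)) '' S) :=
    hSconvex.is_linear_image ⟨fun _ _ => rfl, fun _ _ => rfl⟩
  obtain ⟨B, hB, hBv⟩ := hconv.sub_mem_of_hasDerivAt
    (fun t ht => (hderiv t ht).continuousAt.continuousWithinAt)
    (fun t ht => hderiv t (Set.Ioo_subset_Icc_self ht))
    (fun t ht => ⟨_, hDf _ (hline t (Set.Ioo_subset_Icc_self ht)), rfl⟩)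
  simp only [AffineMap.lineMap_apply_one, AffineMap.lineMap_apply_zero] at hBv
  rw [← hBv]
  exact hpos B hB _ (sub_ne_zero.2 hne)
end

section
/- Let n ∈ ℕ, let N ⊆ ℝⁿ be a compact convex set, let f : ℝⁿ → ℝⁿ be continuously differentiable on a neighbourhood of N, let Q_N and Q_M be quadratic forms on ℝⁿ, and let S be a compact convex set of linear maps ℝⁿ → ℝⁿ such that Df(x) ∈ S for all x ∈ N. If for every B ∈ S the quadratic form v ↦ Q_M(B v) − Q_N(v) is positive definite, then there exists ε > 0 such that for all p₁, p₂ ∈ N one has Q_M(f(p₁) − f(p₂)) − Q_N(p₁ − p₂) ≥ ε‖p₁ − p₂‖². -/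
theorem QuadraticForm.continuous_of_finiteDimensional {E : Type*} [AddCommGroup E] [Module ℝ E]
    [TopologicalSpace E] [IsTopologicalAddGroup E] [ContinuousSMul ℝ E] [T2Space E]
    [FiniteDimensional ℝ E] (Q : QuadraticForm ℝ E) : Continuous Q := by
  let b := Module.finBasis ℝ E
  have h : (Q : E → ℝ) = fun v ↦ ∑ i, ∑ j,
      b.equivFun v i * (b.equivFun v j * QuadraticMap.associated (R := ℝ) Q (b j) (b i)) := by
    funext v
    conv_lhs => rw [← QuadraticMap.associated_eq_self_apply ℝ Q v, ← b.sum_equivFun v]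
    simp only [map_sum, map_smul, LinearMap.sum_apply, LinearMap.smul_apply, smul_eq_mul,
      Finset.mul_sum]
  have hb : Continuous b.equivFun := b.equivFun.toLinearMap.continuous_of_finiteDimensional
  rw [h]
  fun_prop

/-- Mean value theorem for vector-valued maps: if the derivative stays in a compact convex set `S`
of linear maps, then every increment is realised by a member of `S`. -/
theorem Convex.exists_sub_eq_apply_of_fderiv_mem {E F : Type*} [NormedAddCommGroup E]
    [NormedSpace ℝ E] [NormedAddCommGroup F] [NormedSpace ℝ F] {N : Set E} (hN : Convex ℝ N)
    {f : E → F} (hf : ∀ x ∈ N, DifferentiableAt ℝ f x) {S : Set (E →L[ℝ] F)}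
    (hScompact : IsCompact S) (hSconvex : Convex ℝ S) (hDf : ∀ x ∈ N, fderiv ℝ f x ∈ S)
    {p q : E} (hp : p ∈ N) (hq : q ∈ N) : ∃ B ∈ S, f p - f q = B (p - q) := by
  by_contra! hne
  let ev : (E →L[ℝ] F) →L[ℝ] F := ContinuousLinearMap.apply ℝ F (p - q)
  have hclosed : IsClosed (ev '' S) := (hScompact.image ev.continuous).isClosed
  have hconvex : Convex ℝ (ev '' S) := hSconvex.linear_image ev.toLinearMap
  have hnot : f p - f q ∉ ev '' S := by
    rintro ⟨B, hB, h⟩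
    exact hne B hB h.symm
  obtain ⟨φ, u, hφ, hu⟩ := geometric_hahn_banach_closed_point hconvex hclosed hnot
  obtain ⟨z, hz, h⟩ := domain_mvt (f := fun x ↦ φ (f x)) (s := N)
    (f' := fun x ↦ φ.comp (fderiv ℝ f x))
    (fun x hx ↦ (φ.hasFDerivAt.comp x (hf x hx).hasFDerivAt).hasFDerivWithinAt) hN hq hp
  have hlt : φ (fderiv ℝ f z (p - q)) < u :=
    hφ _ ⟨_, hDf z (hN.segment_subset hq hp hz), rfl⟩
  rw [map_sub] at hu
  simp only [ContinuousLinearMap.comp_apply] at h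
  linarith

theorem exists_pos_mul_norm_sq_le_of_isCompact {E F : Type*} [NormedAddCommGroup E]
    [NormedSpace ℝ E] [FiniteDimensional ℝ E] [NormedAddCommGroup F] [NormedSpace ℝ F]
    [FiniteDimensional ℝ F] (Q : QuadraticForm ℝ E) (R : QuadraticForm ℝ F)
    {S : Set (E →L[ℝ] F)} (hS : IsCompact S) (hpos : ∀ B ∈ S, ∀ v, v ≠ 0 → Q v < R (B v)) :
    ∃ ε > (0 : ℝ), ∀ B ∈ S, ∀ v, ε * ‖v‖ ^ 2 ≤ R (B v) - Q v := by
  have hQ := QuadraticForm.continuous_of_finiteDimensional Q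
  have hR := QuadraticForm.continuous_of_finiteDimensional R
  have : ProperSpace E := FiniteDimensional.proper ℝ E
  have hcont : Continuous fun x : (E →L[ℝ] F) × E ↦ R (x.1 x.2) - Q x.2 := by fun_prop
  obtain ⟨ε, hε, h⟩ := (hS.prod (isCompact_sphere (0 : E) 1)).exists_forall_le' (a := 0)
    hcont.continuousOn (fun x hx ↦ sub_pos.2 <| hpos x.1 hx.1 x.2 <| by
      rintro h0
      simpa [h0] using hx.2)
  refine ⟨ε, hε, fun B hB v ↦ ?_⟩
  rcases eq_or_ne v 0 with rfl | hv
  · simp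
  have hv' : ‖v‖ ≠ 0 := norm_ne_zero_iff.2 hv
  have hunit := h (B, ‖v‖⁻¹ • v) ⟨hB, by simp [norm_smul, hv']⟩
  simp only [map_smul, QuadraticMap.map_smul, smul_eq_mul] at hunit
  calc ε * ‖v‖ ^ 2
      ≤ (‖v‖⁻¹ * ‖v‖⁻¹ * R (B v) - ‖v‖⁻¹ * ‖v‖⁻¹ * Q v) * ‖v‖ ^ 2 := by gcongr
    _ = R (B v) - Q v := by field_simp


/-- uniform quadratic strengthening of the cone condition:
under compactness of `N` and of the convex enclosure `S` of the derivative,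
the cone condition holds with a uniform quadratic margin `ε ‖p₁ - p₂‖²`. -/
theorem stmt6 (n : ℕ)
    (N : Set (EuclideanSpace ℝ (Fin n))) (hNcompact : IsCompact N) (hNconvex : Convex ℝ N)
    (f : EuclideanSpace ℝ (Fin n) → EuclideanSpace ℝ (Fin n))
    (hf : ∃ U, IsOpen U ∧ N ⊆ U ∧ ContDiffOn ℝ 1 f U)
    (QN QM : QuadraticForm ℝ (EuclideanSpace ℝ (Fin n)))
    (S : Set (EuclideanSpace ℝ (Fin n) →L[ℝ] EuclideanSpace ℝ (Fin n)))
    (hScompact : IsCompact S) (hSconvex : Convex ℝ S)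
    (hDf : ∀ x ∈ N, fderiv ℝ f x ∈ S)
    (hpos : ∀ B ∈ S, ∀ v : EuclideanSpace ℝ (Fin n), v ≠ 0 → QN v < QM (B v)) :
    ∃ ε > (0 : ℝ), ∀ p₁ ∈ N, ∀ p₂ ∈ N,
      ε * ‖p₁ - p₂‖ ^ 2 ≤ QM (f p₁ - f p₂) - QN (p₁ - p₂) := by
  obtain ⟨U, hU, hNU, hfU⟩ := hf
  obtain ⟨ε, hε, h⟩ := exists_pos_mul_norm_sq_le_of_isCompact QN QM hScompact hpos
  have hdiff : ∀ x ∈ N, DifferentiableAt ℝ f x := fun x hx ↦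
    (hfU.differentiableOn one_ne_zero).differentiableAt (hU.mem_nhds (hNU hx))
  refine ⟨ε, hε, fun p hp q hq ↦ ?_⟩
  obtain ⟨B, hB, hpq⟩ :=
    hNconvex.exists_sub_eq_apply_of_fderiv_mem hdiff hScompact hSconvex hDf hp hq
  rw [hpq]
  exact h B hB (p - q)
end

section
/- Let n, k ∈ ℕ, let N : Fin k → Set ℝⁿ with each N i compact, let Q : Fin k → (quadratic forms on ℝⁿ), let f : ℝⁿ → ℝⁿ, let A : Fin k → Fin k → Prop, and let ε > 0. Assume the cone condition with margin ε: for all i, j with A i j, and all p, q ∈ N i with f(p) ∈ N j and f(q) ∈ N j, one has Q j (f(p) − f(q)) ≥ Q i (p − q) + ε‖p − q‖². Let ω : ℕ → Fin k satisfy A (ω m) (ω (m+1)) for all m, and let p, q : ℕ → ℝⁿ satisfy p(m+1) = f(p(m)), q(m+1) = f(q(m)) and p(m), q(m) ∈ N (ω m) for all m. If p(0) ≠ q(0), then Q (ω 0) (p(0) − q(0)) ≤ 0. -/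
/-- A quadratic form on a finite-dimensional real normed space is bounded by a multiple of the
squared norm. -/
theorem QuadraticForm.exists_le_mul_norm_sq {E : Type*} [NormedAddCommGroup E] [NormedSpace ℝ E]
    [FiniteDimensional ℝ E] (Q : QuadraticForm ℝ E) :
    ∃ C : ℝ, ∀ x, Q x ≤ C * ‖x‖ ^ 2 := by
  refine ⟨‖(QuadraticMap.associated Q).toContinuousBilinearMap‖, fun x => ?_⟩
  have h := (QuadraticMap.associated Q).toContinuousBilinearMap.le_opNorm₂ x x
  have hx : (QuadraticMap.associated Q).toContinuousBilinearMap x x = Q x :=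
    QuadraticMap.associated_eq_self_apply ℝ Q x
  rw [hx, Real.norm_eq_abs] at h
  nlinarith [le_abs_self (Q x)]

/-- A real sequence that is bounded above and grows by at least a fixed multiple `c > 0` of its
current value at each step starts at a nonpositive value. -/
theorem nonpos_of_add_mul_le_succ_of_bddAbove {V : ℕ → ℝ} {c B : ℝ} (hc : 0 < c)
    (hstep : ∀ m, V m + c * V m ≤ V (m + 1)) (hB : ∀ m, V m ≤ B) : V 0 ≤ 0 := by
  by_contra! h0
  have hgrowth : ∀ m : ℕ, V 0 + m * (c * V 0) ≤ V m := by
    intro m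
    induction m with
    | zero => simp
    | succ m ih =>
      have hle : V 0 ≤ V m := le_trans (le_add_of_nonneg_right (by positivity)) ih
      have := mul_le_mul_of_nonneg_left hle hc.le
      push_cast
      linarith [hstep m]
  obtain ⟨m, hm⟩ := exists_nat_gt (B / (c * V 0))
  rw [div_lt_iff₀ (by positivity)] at hm
  linarith [hgrowth m, hB m]


/-- forward-orbit rigidity: for two distinct forward orbits in
compact sets `N i` shadowing the same admissible itinerary, the cone condition
with margin `ε` forces `Q (ω 0) (p 0 - q 0) ≤ 0`. -/
theorem stmt8 (n k : ℕ)
    (N : Fin k → Set (EuclideanSpace ℝ (Fin n)))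
    (hNcompact : ∀ i, IsCompact (N i))
    (Q : Fin k → QuadraticForm ℝ (EuclideanSpace ℝ (Fin n)))
    (f : EuclideanSpace ℝ (Fin n) → EuclideanSpace ℝ (Fin n))
    (A : Fin k → Fin k → Prop) (ε : ℝ) (hε : 0 < ε)
    (hcone : ∀ i j, A i j → ∀ p ∈ N i, ∀ q ∈ N i, f p ∈ N j → f q ∈ N j →
      Q i (p - q) + ε * ‖p - q‖ ^ 2 ≤ Q j (f p - f q))
    (ω : ℕ → Fin k) (hω : ∀ m, A (ω m) (ω (m + 1)))
    (p q : ℕ → EuclideanSpace ℝ (Fin n))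
    (hp : ∀ m, p (m + 1) = f (p m)) (hq : ∀ m, q (m + 1) = f (q m))
    (hpN : ∀ m, p m ∈ N (ω m)) (hqN : ∀ m, q m ∈ N (ω m))
    (hne : p 0 ≠ q 0) :
    Q (ω 0) (p 0 - q 0) ≤ 0 := by
  choose C hC using fun i => (Q i).exists_le_mul_norm_sq
  obtain ⟨K, hK⟩ := (Set.finite_range C).bddAbove
  set D := max K 1
  have hD : 0 < D := lt_max_of_lt_right one_pos
  have hQ : ∀ i x, Q i x ≤ D * ‖x‖ ^ 2 := fun i x => (hC i x).trans <|
    mul_le_mul_of_nonneg_right ((hK (Set.mem_range_self i)).trans (le_max_left _ _)) (sq_nonneg _)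
  obtain ⟨R, hR⟩ := (isCompact_iUnion hNcompact).isBounded.exists_norm_le
  have hdist : ∀ m, ‖p m - q m‖ ≤ R + R := fun m => (norm_sub_le _ _).trans <|
    add_le_add (hR _ (Set.mem_iUnion_of_mem _ (hpN m))) (hR _ (Set.mem_iUnion_of_mem _ (hqN m)))
  refine nonpos_of_add_mul_le_succ_of_bddAbove (V := fun m => Q (ω m) (p m - q m))
    (c := ε / D) (B := D * (R + R) ^ 2) (by positivity) (fun m => ?_) (fun m => ?_)
  · have h := hcone _ _ (hω m) _ (hpN m) _ (hqN m) (hp m ▸ hpN (m + 1)) (hq m ▸ hqN (m + 1))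
    rw [← hp, ← hq] at h
    refine le_trans (add_le_add_right ?_ _) h
    calc ε / D * Q (ω m) (p m - q m) ≤ ε / D * (D * ‖p m - q m‖ ^ 2) :=
          mul_le_mul_of_nonneg_left (hQ _ _) (by positivity)
      _ = ε * ‖p m - q m‖ ^ 2 := by field_simp
  · refine (hQ _ _).trans ?_
    gcongr
    exact hdist m
end

section
/- Let n, k ∈ ℕ, let N : Fin k → Set ℝⁿ with each N i compact, let Q : Fin k → (quadratic forms on ℝⁿ), let f : ℝⁿ → ℝⁿ, let A : Fin k → Fin k → Prop, and let ε > 0. Assume the cone condition with margin ε: for all i, j with A i j, and all p, q ∈ N i with f(p) ∈ N j and f(q) ∈ N j, one has Q j (f(p) − f(q)) ≥ Q i (p − q) + ε‖p − q‖². Let ω : ℤ → Fin k satisfy A (ω m) (ω (m+1)) for all m ∈ ℤ, and let p, q : ℤ → ℝⁿ satisfy p(m+1) = f(p(m)), q(m+1) = f(q(m)) and p(m), q(m) ∈ N (ω m) for all m ∈ ℤ. Then p(m) = q(m) for all m ∈ ℤ; i.e. each admissible bi-infinite itinerary is realised by at most one orbit. -/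
open Filter Topology

/-- A quadratic form on a finite-dimensional normed space is bounded by a multiple of the square of
the norm. -/
theorem QuadraticForm.exists_abs_le_mul_norm_sq {E : Type*} [NormedAddCommGroup E]
    [NormedSpace ℝ E] [FiniteDimensional ℝ E] (Q : QuadraticForm ℝ E) :
    ∃ C, 0 ≤ C ∧ ∀ x, |Q x| ≤ C * ‖x‖ ^ 2 := by
  set B := (QuadraticMap.associated (R := ℝ) Q).toContinuousBilinearMap
  refine ⟨‖B‖, B.opNorm_nonneg, fun x => ?_⟩
  have hB : B x x = Q x := QuadraticMap.associated_eq_self_apply ℝ Q x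
  rw [← hB, ← Real.norm_eq_abs, sq, ← mul_assoc]
  exact B.le_opNorm₂ x x

/-- A bounded real sequence indexed by `ℤ` whose values are controlled by its forward increments
vanishes. -/
theorem eq_zero_of_bounded_of_abs_le_increment {V : ℤ → ℝ} {K M : ℝ} (hmono : Monotone V)
    (hM : ∀ m, |V m| ≤ M) (hV : ∀ m, |V m| ≤ K * (V (m + 1) - V m)) (m : ℤ) : V m = 0 := by
  have hlim {l : Filter ℤ} {L : ℝ} (hL : Tendsto V l (𝓝 L))
      (hl : Tendsto (fun m : ℤ => m + 1) l l) : Tendsto V l (𝓝 0) := by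
    have h : Tendsto (fun m => K * (V (m + 1) - V m)) l (𝓝 0) := by
      simpa using ((hL.comp hl).sub hL).const_mul K
    exact squeeze_zero_norm hV h
  have htop := hlim (tendsto_atTop_ciSup hmono
    ⟨M, Set.forall_mem_range.2 fun m => (abs_le.1 (hM m)).2⟩)
    (tendsto_atTop_add_const_right _ 1 tendsto_id)
  have hbot := hlim (tendsto_atBot_ciInf hmono
    ⟨-M, Set.forall_mem_range.2 fun m => (abs_le.1 (hM m)).1⟩)
    (tendsto_atBot_add_const_right _ 1 tendsto_id)
  exact le_antisymm (hmono.ge_of_tendsto htop m) (hmono.le_of_tendsto hbot m)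


/-- uniqueness of shadowing orbits: two bi-infinite orbits in
compact sets `N i` shadowing the same admissible itinerary of the topological
Markov chain coincide, by the cone condition with margin `ε`. -/
theorem stmt9 (n k : ℕ)
    (N : Fin k → Set (EuclideanSpace ℝ (Fin n)))
    (hNcompact : ∀ i, IsCompact (N i))
    (Q : Fin k → QuadraticForm ℝ (EuclideanSpace ℝ (Fin n)))
    (f : EuclideanSpace ℝ (Fin n) → EuclideanSpace ℝ (Fin n))
    (A : Fin k → Fin k → Prop) (ε : ℝ) (hε : 0 < ε)
    (hcone : ∀ i j, A i j → ∀ p ∈ N i, ∀ q ∈ N i, f p ∈ N j → f q ∈ N j →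
      Q i (p - q) + ε * ‖p - q‖ ^ 2 ≤ Q j (f p - f q))
    (ω : ℤ → Fin k) (hω : ∀ m : ℤ, A (ω m) (ω (m + 1)))
    (p q : ℤ → EuclideanSpace ℝ (Fin n))
    (hp : ∀ m : ℤ, p (m + 1) = f (p m)) (hq : ∀ m : ℤ, q (m + 1) = f (q m))
    (hpN : ∀ m : ℤ, p m ∈ N (ω m)) (hqN : ∀ m : ℤ, q m ∈ N (ω m)) :
    ∀ m : ℤ, p m = q m := by
  choose C hC0 hC using fun i => (Q i).exists_abs_le_mul_norm_sq
  set S := ∑ i, C i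
  have hS0 : 0 ≤ S := Finset.sum_nonneg fun i _ => hC0 i
  have hCS (i : Fin k) : C i ≤ S :=
    Finset.single_le_sum (fun i _ => hC0 i) (Finset.mem_univ i)
  obtain ⟨R, hR⟩ := (isCompact_iUnion hNcompact).isBounded.exists_norm_le
  have hd (m : ℤ) : ‖p m - q m‖ ≤ R + R :=
    (norm_sub_le _ _).trans (add_le_add (hR _ (Set.mem_iUnion_of_mem _ (hpN m)))
      (hR _ (Set.mem_iUnion_of_mem _ (hqN m))))
  set V : ℤ → ℝ := fun m => Q (ω m) (p m - q m)
  have hVd (m : ℤ) : |V m| ≤ S * ‖p m - q m‖ ^ 2 :=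
    (hC _ _).trans (mul_le_mul_of_nonneg_right (hCS _) (sq_nonneg _))
  have hstep (m : ℤ) : V m + ε * ‖p m - q m‖ ^ 2 ≤ V (m + 1) := by
    have h := hcone _ _ (hω m) (p m) (hpN m) (q m) (hqN m) (hp m ▸ hpN (m + 1))
      (hq m ▸ hqN (m + 1))
    rwa [← hp, ← hq] at h
  have hmono : Monotone V := monotone_int_of_le_succ fun m =>
    (le_add_of_nonneg_right (by positivity)).trans (hstep m)
  have hV0 : ∀ m, V m = 0 := by
    refine eq_zero_of_bounded_of_abs_le_increment (K := S / ε) (M := S * (R + R) ^ 2) hmono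
      (fun m => (hVd m).trans ?_) (fun m => (hVd m).trans ?_)
    · have := hd m
      gcongr
    · rw [div_mul_eq_mul_div, mul_div_assoc]
      refine mul_le_mul_of_nonneg_left ?_ hS0
      rw [le_div_iff₀ hε]
      linarith [hstep m]
  intro m
  have h := hstep m
  rw [hV0, hV0, zero_add] at h
  have hsq : ‖p m - q m‖ ^ 2 ≤ 0 := nonpos_of_mul_nonpos_right h hε
  rw [← sub_eq_zero, ← norm_eq_zero]
  exact pow_eq_zero_iff two_ne_zero |>.1 (le_antisymm hsq (sq_nonneg _))
end

section
/- Let t_L > 0 and t_R > 0, and suppose d ∈ (0,1) satisfies t_L^d + t_R^d = (1 + t_L + t_R)^d. Then d > max{ log(1 + t_R/(1 + t_L)) / log(1 + (1 + t_R)/t_L) , log(1 + t_L/(1 + t_R)) / log(1 + (1 + t_L)/t_R) }. -/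
theorem log_div_log_lt_of_rpow_add_rpow_eq {a b d : ℝ} (ha : 0 < a) (hb : 0 < b) (hd : d < 1)
    (h : a ^ d + b ^ d = (1 + a + b) ^ d) :
    Real.log (1 + b / (1 + a)) / Real.log (1 + (1 + b) / a) < d := by
  have hs : 0 < 1 + a + b := by positivity
  have hb_lt : b / (1 + a + b) < (b / (1 + a + b)) ^ d :=
    Real.self_lt_rpow_of_lt_one (by positivity) ((div_lt_one hs).2 (by linarith)) hd
  have hsum : (a / (1 + a + b)) ^ d + (b / (1 + a + b)) ^ d = 1 := by
    rw [Real.div_rpow ha.le hs.le, Real.div_rpow hb.le hs.le, ← add_div, h,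
      div_self (Real.rpow_pos_of_pos hs d).ne']
  have hlt : (a / (1 + a + b)) ^ d < (1 + a) / (1 + a + b) := by
    have hcompl : (1 + a) / (1 + a + b) = 1 - b / (1 + a + b) := by
      field_simp
      ring
    linarith
  have hlog := Real.log_lt_log (by positivity) hlt
  rw [Real.log_rpow (by positivity)] at hlog
  have hleft : 1 + b / (1 + a) = ((1 + a) / (1 + a + b))⁻¹ := by
    field_simp
  have hright : 1 + (1 + b) / a = (a / (1 + a + b))⁻¹ := by
    field_simp
    ring
  have hpos : 0 < Real.log (1 + (1 + b) / a) :=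
    Real.log_pos (lt_add_of_pos_right 1 (by positivity))
  rw [div_lt_iff₀ hpos, hleft, hright, Real.log_inv, Real.log_inv]
  linarith


/-- lower bound for the solution `d ∈ (0,1)` of the thickness
equation `t_L^d + t_R^d = (1 + t_L + t_R)^d`. -/
theorem stmt10 (tL tR d : ℝ) (htL : 0 < tL) (htR : 0 < tR)
    (hd0 : 0 < d) (hd1 : d < 1)
    (heq : tL ^ d + tR ^ d = (1 + tL + tR) ^ d) :
    d > max (Real.log (1 + tR / (1 + tL)) / Real.log (1 + (1 + tR) / tL))
            (Real.log (1 + tL / (1 + tR)) / Real.log (1 + (1 + tL) / tR)) := by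
  refine max_lt (log_div_log_lt_of_rpow_add_rpow_eq htL htR hd1 heq)
    (log_div_log_lt_of_rpow_add_rpow_eq htR htL hd1 ?_)
  rw [add_comm, heq, add_right_comm]
end
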